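/- Let Q be a finite simple graph on seven distinct vertices u, x1, x2, x3, v, w1, w2 containing the path u–x1–x2–x3–v, and suppose that each of w1 and w2 has at least three neighbors among the path vertices P = {u, x1, x2, x3, v}. Then every set S of vertices such that Q − S is acyclic satisfies |S ∩ V(Q)| ≥ 2. (Counting claim from the proof that rules 14–18 are correct.) -/

import Mathlib

namespace SimpleGraph

variable {V : Type*} {G : SimpleGraph V}

theorem IsAcyclic.spanningCoe {s : Set V} {G : SimpleGraph s} (hG : G.IsAcyclic) :
    G.spanningCoe.IsAcyclic := by
  intro a c hc
  have hs : ∀ b ∈ c.support, b ∈ s := by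
    intro b hb
    obtain ⟨e, he, hbe⟩ := (Walk.mem_support_iff_exists_mem_edges_of_not_nil hc.not_nil).1 hb
    obtain ⟨d, rfl⟩ := Sym2.mem_iff_exists.1 hbe
    obtain ⟨-, b', -, -, rfl, -⟩ := c.adj_of_mem_edges he
    exact b'.2
  rw [← induce_spanningCoe (G := G)] at hG
  refine hG (c.induce s hs) ?_
  have hinj : Function.Injective (Embedding.induce (G := G.spanningCoe) s).toHom :=
    (Embedding.induce (G := G.spanningCoe) s).injective
  rwa [← Walk.isCycle_map_iff_of_injective hinj, Walk.map_induce]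

theorem IsAcyclic.eq_of_adj_of_mem_support (hG : G.IsAcyclic) {x y w a b : V} (p : G.Walk x y)
    (hw : w ∉ p.support) (ha : a ∈ p.support) (hb : b ∈ p.support)
    (hwa : G.Adj w a) (hwb : G.Adj w b) : a = b := by
  classical
  let q := ((p.takeUntil a ha).reverse.append (p.takeUntil b hb)).bypass
  have hq : w ∉ q.support := by
    intro h
    have h := Walk.support_bypass_subset_support _ h
    rw [Walk.mem_support_append_iff, Walk.support_reverse, List.mem_reverse] at h
    exact h.elim (fun h => hw (p.support_takeUntil_subset_support ha h))
      (fun h => hw (p.support_takeUntil_subset_support hb h))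
  have hp : (Walk.cons hwa q).IsPath := (Walk.bypass_isPath _).cons hq
  have hl := congrArg (fun r : G.Path w b => r.1.length)
    ((hG.subsingleton_path w b).elim ⟨_, hp⟩ (Path.singleton hwb))
  simp only [Walk.length_cons, Path.singleton, Walk.length_nil] at hl
  exact Walk.eq_of_length_eq_zero (p := q) (by omega)

theorem IsAcyclic.not_two_vertices_adj_two_walks (hG : G.IsAcyclic)
    {x y z t w₁ w₂ a₁ b₁ a₂ b₂ : V}
    (p : G.Walk x y) (q : G.Walk z t) (hw : w₁ ≠ w₂)
    (hp₁ : w₁ ∉ p.support) (hp₂ : w₂ ∉ p.support) (hq₁ : w₁ ∉ q.support) (hq₂ : w₂ ∉ q.support)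
    (hab₁ : a₁ ≠ b₁) (hab₂ : a₂ ≠ b₂)
    (ha₁ : a₁ ∈ p.support ∨ a₁ ∈ q.support) (hb₁ : b₁ ∈ p.support ∨ b₁ ∈ q.support)
    (ha₂ : a₂ ∈ p.support ∨ a₂ ∈ q.support) (hb₂ : b₂ ∈ p.support ∨ b₂ ∈ q.support)
    (hwa₁ : G.Adj w₁ a₁) (hwb₁ : G.Adj w₁ b₁) (hwa₂ : G.Adj w₂ a₂) (hwb₂ : G.Adj w₂ b₂) :
    False := by
  classical
  have exists_adj_pair {w a b : V} (hp : w ∉ p.support) (hq : w ∉ q.support) (hab : a ≠ b)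
      (ha : a ∈ p.support ∨ a ∈ q.support) (hb : b ∈ p.support ∨ b ∈ q.support)
      (hwa : G.Adj w a) (hwb : G.Adj w b) :
      ∃ c ∈ p.support, ∃ d ∈ q.support, c ≠ d ∧ G.Adj w c ∧ G.Adj w d := by
    rcases ha with ha | ha <;> rcases hb with hb | hb
    · exact absurd (hG.eq_of_adj_of_mem_support p hp ha hb hwa hwb) hab
    · exact ⟨a, ha, b, hb, hab, hwa, hwb⟩
    · exact ⟨b, hb, a, ha, hab.symm, hwb, hwa⟩
    · exact absurd (hG.eq_of_adj_of_mem_support q hq ha hb hwa hwb) hab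
  obtain ⟨c₁, hc₁, d₁, hd₁, hcd₁, hwc₁, hwd₁⟩ := exists_adj_pair hp₁ hq₁ hab₁ ha₁ hb₁ hwa₁ hwb₁
  obtain ⟨c₂, hc₂, d₂, hd₂, -, hwc₂, hwd₂⟩ := exists_adj_pair hp₂ hq₂ hab₂ ha₂ hb₂ hwa₂ hwb₂
  let r := (p.append (p.dropUntil c₂ hc₂).reverse).append
    (Walk.cons hwc₂.symm (Walk.cons hwd₂ ((q.takeUntil d₂ hd₂).reverse.append q)))
  have hpr : w₁ ∉ (p.dropUntil c₂ hc₂).support :=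
    fun h => hp₁ (p.support_dropUntil_subset_support hc₂ h)
  have hqr : w₁ ∉ (q.takeUntil d₂ hd₂).support :=
    fun h => hq₁ (q.support_takeUntil_subset_support hd₂ h)
  have hc₂w : w₁ ≠ c₂ := fun h => hp₁ (h ▸ hc₂)
  refine hcd₁ (hG.eq_of_adj_of_mem_support r ?_ ?_ ?_ hwc₁ hwd₁)
  · simp [r, Walk.mem_support_append_iff, hp₁, hq₁, hpr, hqr, hw, hc₂w]
  · simp [r, Walk.mem_support_append_iff, hc₁]
  · simp [r, Walk.mem_support_append_iff, hd₁]

end SimpleGraph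

theorem Set.exists_ne_mem_ne_of_three_le_ncard {α : Type*} {s : Set α} (hs : 3 ≤ s.ncard) (c : α) :
    ∃ a ∈ s, ∃ b ∈ s, a ≠ b ∧ a ≠ c ∧ b ≠ c := by
  have h := Set.pred_ncard_le_ncard_sdiff_singleton s c
  have hfin : (s \ {c}).Finite := (Set.finite_of_ncard_pos (by omega)).sdiff
  obtain ⟨a, ha, b, hb, hab⟩ := (Set.one_lt_ncard hfin).1 (by omega : 1 < (s \ {c}).ncard)
  exact ⟨a, ha.1, b, hb.1, hab, ha.2, hb.2⟩

/-- Counting claim from the proof that rules 14–18 are correct: in a graph `Q` on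
the seven vertices `u, x1, x2, x3, v, w1, w2` containing the path
`u–x1–x2–x3–v`, where each of `w1` and `w2` has at least three neighbors among
`P = {u, x1, x2, x3, v}`, every set `S` with `Q − S` acyclic satisfies
`|S ∩ V(Q)| ≥ 2`. -/
theorem stmt_10 {V : Type*} [Fintype V]
    (Q : SimpleGraph V) (u x1 x2 x3 v w1 w2 : V)
    (hnodup : [u, x1, x2, x3, v, w1, w2].Nodup)
    (huniv : (Set.univ : Set V) = {u, x1, x2, x3, v, w1, w2})
    (h1 : Q.Adj u x1) (h2 : Q.Adj x1 x2) (h3 : Q.Adj x2 x3) (h4 : Q.Adj x3 v)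
    (hw1 : 3 ≤ (Q.neighborSet w1 ∩ {u, x1, x2, x3, v}).ncard)
    (hw2 : 3 ≤ (Q.neighborSet w2 ∩ {u, x1, x2, x3, v}).ncard)
    (S : Set V) (hS : (Q.induce Sᶜ).IsAcyclic) :
    2 ≤ (S ∩ {u, x1, x2, x3, v, w1, w2}).ncard := by
  by_contra hlt
  rw [← huniv, Set.inter_univ] at hlt
  have : Nonempty V := ⟨u⟩
  obtain ⟨s, hs⟩ := (Set.ncard_le_one_iff_subset_singleton (s := S)).1 (by omega)
  have hmem {a : V} (ha : a ≠ s) : a ∈ Sᶜ := fun h => ha (hs h)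
  let H := (Q.induce Sᶜ).spanningCoe
  have hH : H.IsAcyclic := hS.spanningCoe
  have adj {a b : V} (h : Q.Adj a b) (ha : a ≠ s) (hb : b ≠ s) : H.Adj a b := by
    simpa [H, h] using And.intro (hmem ha) (hmem hb)
  obtain ⟨a₁, ⟨hwa₁, ha₁⟩, b₁, ⟨hwb₁, hb₁⟩, hab₁, has₁, hbs₁⟩ :=
    Set.exists_ne_mem_ne_of_three_le_ncard hw1 s
  obtain ⟨a₂, ⟨hwa₂, ha₂⟩, b₂, ⟨hwb₂, hb₂⟩, hab₂, has₂, hbs₂⟩ :=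
    Set.exists_ne_mem_ne_of_three_le_ncard hw2 s
  rw [SimpleGraph.mem_neighborSet] at hwa₁ hwb₁ hwa₂ hwb₂
  simp only [List.nodup_cons, List.mem_cons, List.not_mem_nil, or_false, not_or,
    List.nodup_nil, and_true, not_false_eq_true, Set.mem_insert_iff, Set.mem_singleton_iff] at *
  have hsu : s = u ∨ s = x1 ∨ s = x2 ∨ s = x3 ∨ s = v ∨ s = w1 ∨ s = w2 := by
    simpa [huniv] using Set.mem_univ s
  by_cases hsw₁ : w1 = s
  · let p := SimpleGraph.Walk.cons (adj h1 (by grind) (by grind))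
      (.cons (adj h2 (by grind) (by grind)) (.cons (adj h3 (by grind) (by grind))
        (adj h4 (by grind) (by grind)).toWalk))
    refine hab₂ (hH.eq_of_adj_of_mem_support p ?_ ?_ ?_ (adj hwa₂ ?_ has₂) (adj hwb₂ ?_ hbs₂)) <;>
      simp [p] <;> grind
  by_cases hsw₂ : w2 = s
  · let p := SimpleGraph.Walk.cons (adj h1 (by grind) (by grind))
      (.cons (adj h2 (by grind) (by grind)) (.cons (adj h3 (by grind) (by grind))
        (adj h4 (by grind) (by grind)).toWalk))
    refine hab₁ (hH.eq_of_adj_of_mem_support p ?_ ?_ ?_ (adj hwa₁ ?_ has₁) (adj hwb₁ ?_ hbs₁)) <;>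
      simp [p] <;> grind
  have key {x y z t : V} (p : H.Walk x y) (q : H.Walk z t)
      (hp₁ : w1 ∉ p.support) (hp₂ : w2 ∉ p.support) (hq₁ : w1 ∉ q.support) (hq₂ : w2 ∉ q.support)
      (h : ∀ c, (c = u ∨ c = x1 ∨ c = x2 ∨ c = x3 ∨ c = v) → c ≠ s →
        c ∈ p.support ∨ c ∈ q.support) : False :=
    hH.not_two_vertices_adj_two_walks p q (by grind) hp₁ hp₂ hq₁ hq₂ hab₁ hab₂
      (h _ ha₁ has₁) (h _ hb₁ hbs₁) (h _ ha₂ has₂) (h _ hb₂ hbs₂)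
      (adj hwa₁ hsw₁ has₁) (adj hwb₁ hsw₁ hbs₁) (adj hwa₂ hsw₂ has₂) (adj hwb₂ hsw₂ hbs₂)
  rcases hsu with h | h | h | h | h | h | h
  · refine key (.cons (adj h2 ?_ ?_) (.cons (adj h3 ?_ ?_) (adj h4 ?_ ?_).toWalk))
      (.nil : H.Walk v v) ?_ ?_ ?_ ?_ ?_ <;> simp <;> grind
  · refine key (.cons (adj h3 ?_ ?_) (adj h4 ?_ ?_).toWalk)
      (.nil : H.Walk u u) ?_ ?_ ?_ ?_ ?_ <;> simp <;> grind
  · refine key (adj h1 ?_ ?_).toWalk (adj h4 ?_ ?_).toWalk ?_ ?_ ?_ ?_ ?_ <;> simp <;> grind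
  · refine key (.cons (adj h1 ?_ ?_) (adj h2 ?_ ?_).toWalk)
      (.nil : H.Walk v v) ?_ ?_ ?_ ?_ ?_ <;> simp <;> grind
  · refine key (.cons (adj h1 ?_ ?_) (.cons (adj h2 ?_ ?_) (adj h3 ?_ ?_).toWalk))
      (.nil : H.Walk u u) ?_ ?_ ?_ ?_ ?_ <;> simp <;> grind
  · exact hsw₁ h.symm
  · exact hsw₂ h.symm
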